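/- Let (W,S) be an irreducible Coxeter system with W infinite, and let H be a non-trivial finite subgroup of W. Then H is not a normal subgroup of W. -/

import Mathlib

/-!
Statement 8 (Assertion 2): Let (W,S) be an irreducible Coxeter system with W infinite, and let
H be a non-trivial finite subgroup of W. Then H is not a normal subgroup of W.
-/

noncomputable section

namespace CoxeterPaper

variable {B : Type*} {W : Type*} [Group W]

/-- The Coxeter graph of `M`: vertex set `B`, with `s, t` joined by an edge iff `m_{s,t} ≥ 3`
(where `m_{s,t} = ∞` is encoded by `M s t = 0`). -/
def coxeterGraph (M : CoxeterMatrix B) : SimpleGraph B :=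
  SimpleGraph.fromRel (fun s t => M s t = 0 ∨ 3 ≤ M s t)

/-- The entries `-2 cos (π / m_{s,t})` of the (doubled) canonical bilinear form; the convention
`m_{s,t} = 0` for `∞` gives `-2`. -/
def cartanEntry (M : CoxeterMatrix B) (s t : B) : ℝ := -2 * Real.cos (Real.pi / M s t)

lemma cartanEntry_self (M : CoxeterMatrix B) (s : B) : cartanEntry M s s = 2 := by
  simp [cartanEntry]

lemma cartanEntry_comm (M : CoxeterMatrix B) (s t : B) :
    cartanEntry M s t = cartanEntry M t s := by
  rw [cartanEntry, M.symmetric, cartanEntry]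

/-- The linear form `v ↦ 2 B(α_s, v)` on the geometric representation. -/
def simpleCoroot (M : CoxeterMatrix B) (s : B) : (B →₀ ℝ) →ₗ[ℝ] ℝ :=
  Finsupp.linearCombination ℝ (cartanEntry M s)

/-- The simple root `α_s`. -/
def simpleRoot (s : B) : B →₀ ℝ := Finsupp.single s 1

lemma simpleCoroot_simpleRoot (M : CoxeterMatrix B) (s t : B) :
    simpleCoroot M s (simpleRoot t) = cartanEntry M s t := by
  simp [simpleCoroot, simpleRoot]

lemma simpleCoroot_simpleRoot_self (M : CoxeterMatrix B) (s : B) :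
    simpleCoroot M s (simpleRoot s) = 2 := by
  rw [simpleCoroot_simpleRoot, cartanEntry_self]

/-- The reflection in the simple root `α_s`. -/
def simpleReflection (M : CoxeterMatrix B) (s : B) : (B →₀ ℝ) ≃ₗ[ℝ] (B →₀ ℝ) :=
  Module.reflection (simpleCoroot_simpleRoot_self M s)

lemma simpleReflection_apply (M : CoxeterMatrix B) (s : B) (v : B →₀ ℝ) :
    simpleReflection M s v = v - simpleCoroot M s v • simpleRoot s :=
  Module.reflection_apply _ _

section Chebyshev

open Polynomial.Chebyshev

lemma chebyshev_coeff_eq_zero {m : ℕ} (hm : 3 ≤ m) {t : ℝ}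
    (ht : t = 2 * Real.cos (2 * (Real.pi / m))) :
    (S ℝ (((m : ℤ) - 2) / 2)).eval t *
      ((S ℝ (((m : ℤ) - 1) / 2)).eval t + (S ℝ (((m : ℤ) - 3) / 2)).eval t) = 0 ∧
    (S ℝ (((m : ℤ) - 1) / 2)).eval t *
      ((S ℝ ((m : ℤ) / 2)).eval t + (S ℝ (((m : ℤ) - 2) / 2)).eval t) = 0 := by
  have hm0 : (0 : ℝ) < m := by positivity
  have hm3 : (3 : ℝ) ≤ m := by exact_mod_cast hm
  have hsin : Real.sin (2 * (Real.pi / m)) ≠ 0 := by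
    refine (Real.sin_pos_of_pos_of_lt_pi (by positivity) ?_).ne'
    rw [← mul_div_assoc, div_lt_iff₀ hm0]
    nlinarith [Real.pi_pos]
  have hS (n : ℤ) := S_two_mul_real_cos (2 * (Real.pi / m)) n
  rw [← ht] at hS
  obtain ⟨k, hk | hk⟩ := Int.even_or_odd' (m : ℤ)
  · have hk' : (m : ℝ) = 2 * k := by exact_mod_cast hk
    have hzero : (S ℝ (k - 1)).eval t = 0 := by
      have h := hS (k - 1)
      have harg : (((k - 1 : ℤ) : ℝ) + 1) * (2 * (Real.pi / m)) = Real.pi := by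
        push_cast
        field_simp
        linarith
      rw [harg, Real.sin_pi] at h
      exact (mul_eq_zero.1 h).resolve_right hsin
    have e₁ : ((m : ℤ) - 2) / 2 = k - 1 := by lia
    have e₂ : ((m : ℤ) - 1) / 2 = k - 1 := by lia
    rw [e₁, e₂, hzero]
    simp
  · have hk' : (m : ℝ) = 2 * k + 1 := by exact_mod_cast hk
    have hzero : (S ℝ k).eval t + (S ℝ (k - 1)).eval t = 0 := by
      have h₁ := hS k
      have h₂ := hS (k - 1)
      have harg : ((k : ℝ) + 1) * (2 * (Real.pi / m)) =
          2 * Real.pi - (((k - 1 : ℤ) : ℝ) + 1) * (2 * (Real.pi / m)) := by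
        push_cast
        field_simp
        linarith
      rw [harg, Real.sin_two_pi_sub, ← h₂] at h₁
      refine (mul_eq_zero.1 (?_ : _ * Real.sin (2 * (Real.pi / m)) = 0)).resolve_right hsin
      linarith
    have e₁ : ((m : ℤ) - 2) / 2 = k - 1 := by lia
    have e₂ : ((m : ℤ) - 1) / 2 = k := by lia
    have e₃ : ((m : ℤ) - 3) / 2 = k - 1 := by lia
    have e₄ : (m : ℤ) / 2 = k := by lia
    rw [e₁, e₂, e₃, e₄, hzero]
    simp

end Chebyshev

lemma eq_of_coxeterMatrix_eq_one {M : CoxeterMatrix B} {s t : B} (h : M s t = 1) : s = t := by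
  by_contra hne
  exact M.off_diagonal s t hne h

lemma isLiftable_simpleReflection (M : CoxeterMatrix B) :
    M.IsLiftable (simpleReflection M) := by
  intro s t
  obtain h | h | h | h : M s t = 0 ∨ M s t = 1 ∨ M s t = 2 ∨ 3 ≤ M s t := by lia
  · simp [h]
  · obtain rfl := eq_of_coxeterMatrix_eq_one h
    rw [h, pow_one]
    ext1 v
    exact Module.involutive_reflection (simpleCoroot_simpleRoot_self M s) v
  · have hst : cartanEntry M s t = 0 := by simp [cartanEntry, h]
    have hts : cartanEntry M t s = 0 := by rw [cartanEntry_comm, hst]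
    rw [h]
    ext1 v
    simp only [pow_two, LinearEquiv.mul_apply, simpleReflection_apply, map_sub, map_smul,
      simpleCoroot_simpleRoot, hst, hts, cartanEntry_self, LinearEquiv.coe_one, id]
    module
  · ext1 v
    have key := Module.reflection_mul_reflection_pow_apply (simpleCoroot_simpleRoot_self M s)
      (simpleCoroot_simpleRoot_self M t) (M s t) v
    obtain ⟨h₁, h₂⟩ := chebyshev_coeff_eq_zero h
      (t := simpleCoroot M s (simpleRoot t) * simpleCoroot M t (simpleRoot s) - 2) (by
        rw [simpleCoroot_simpleRoot, simpleCoroot_simpleRoot, cartanEntry_comm M t s, cartanEntry,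
          Real.cos_two_mul]
        ring)
    rw [h₁, h₂, zero_smul, zero_smul, add_zero, add_zero] at key
    exact key

/-- The geometric representation of a Coxeter system. -/
def geometricRep {M : CoxeterMatrix B} (cs : CoxeterSystem M W) :
    W →* ((B →₀ ℝ) ≃ₗ[ℝ] (B →₀ ℝ)) :=
  cs.lift ⟨simpleReflection M, isLiftable_simpleReflection M⟩

section GeometricRep

variable {M : CoxeterMatrix B} (cs : CoxeterSystem M W)

lemma geometricRep_simple (s : B) (v : B →₀ ℝ) :
    geometricRep cs (cs.simple s) v = v - simpleCoroot M s v • simpleRoot s := by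
  rw [geometricRep, cs.lift_apply_simple, simpleReflection_apply]

lemma geometricRep_simple_simpleRoot (s : B) :
    geometricRep cs (cs.simple s) (simpleRoot s) = -simpleRoot s := by
  rw [geometricRep_simple, simpleCoroot_simpleRoot_self]
  module

/-- The sequence `sin (k π / m) / sin (π / m)`, or `k` if `m = 0`, is nonnegative for `k ≤ m`. -/
lemma exists_nonneg_recurrence {m : ℕ} (hm : m ≠ 1) :
    ∃ u : ℕ → ℝ, u 0 = 0 ∧ u 1 = 1 ∧
      (∀ k, u (k + 2) = 2 * Real.cos (Real.pi / m) * u (k + 1) - u k) ∧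
      ∀ k, (m ≠ 0 → k ≤ m) → 0 ≤ u k := by
  obtain rfl | h0 := eq_or_ne m 0
  · refine ⟨fun k ↦ k, by simp, by simp, fun k ↦ ?_, fun k _ ↦ by positivity⟩
    simp
    ring
  · have hm0 : (0 : ℝ) < m := by positivity
    have hm2 : (2 : ℝ) ≤ m := by exact_mod_cast (by lia : 2 ≤ m)
    have hsin : 0 < Real.sin (Real.pi / m) := by
      refine Real.sin_pos_of_pos_of_lt_pi (by positivity) ?_
      rw [div_lt_iff₀ hm0]
      nlinarith [Real.pi_pos]
    refine ⟨fun k ↦ Real.sin (k * (Real.pi / m)) / Real.sin (Real.pi / m), by simp,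
      by simp [hsin.ne'], fun k ↦ ?_, fun k hk ↦ ?_⟩
    · have h₁ : ((k + 2 : ℕ) : ℝ) * (Real.pi / m) =
          ((k + 1 : ℕ) : ℝ) * (Real.pi / m) + Real.pi / m := by push_cast; ring
      have h₂ : (k : ℝ) * (Real.pi / m) =
          ((k + 1 : ℕ) : ℝ) * (Real.pi / m) - Real.pi / m := by push_cast; ring
      beta_reduce
      rw [h₁, h₂, Real.sin_add, Real.sin_sub]
      field_simp
      ring
    · refine div_nonneg (Real.sin_nonneg_of_nonneg_of_le_pi (by positivity) ?_) hsin.le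
      have : (k : ℝ) ≤ m := by exact_mod_cast hk h0
      rw [← mul_div_assoc, div_le_iff₀ hm0]
      nlinarith [Real.pi_pos]

open CoxeterSystem in
lemma geometricRep_alternatingWord (s t : B) {u : ℕ → ℝ} (h0 : u 0 = 0) (h1 : u 1 = 1)
    (hu : ∀ k, u (k + 2) = 2 * Real.cos (Real.pi / M s t) * u (k + 1) - u k) (k : ℕ) :
    geometricRep cs (cs.wordProd (alternatingWord s t k)) (simpleRoot s) =
      if Even k then u (k + 1) • simpleRoot s + u k • simpleRoot t
      else u k • simpleRoot s + u (k + 1) • simpleRoot t := by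
  have hst : cartanEntry M s t = -2 * Real.cos (Real.pi / M s t) := rfl
  have hts : cartanEntry M t s = -2 * Real.cos (Real.pi / M s t) := by rw [cartanEntry_comm, hst]
  induction k with
  | zero => simp [h0, h1, alternatingWord]
  | succ k ih =>
    rw [alternatingWord_succ', cs.wordProd_cons, map_mul, LinearEquiv.mul_apply, ih]
    by_cases hk : Even k
    · have hk' : ¬ Even (k + 1) := by simpa [Nat.even_add_one] using hk
      simp only [hk, hk', if_true, if_false, geometricRep_simple, map_add, map_smul,
        simpleCoroot_simpleRoot, hts, cartanEntry_self, hu k]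
      module
    · have hk' : Even (k + 1) := by simpa [Nat.even_add_one] using hk
      simp only [hk, hk', if_true, if_false, geometricRep_simple, map_add, map_smul,
        simpleCoroot_simpleRoot, hst, cartanEntry_self, hu k]
      module

lemma simpleRoot_nonneg (s : B) : 0 ≤ simpleRoot s := by
  simp [simpleRoot]

open CoxeterSystem in
/-- If `t` but not `s` is a right descent of `w`, then `w` is the product, with lengths adding up,
of an element with neither descent and an alternating word in `s` and `t`. -/
lemma exists_alternatingWord_factor {w : W} {s t : B} (ht : cs.IsRightDescent w t)
    (hs : ¬ cs.IsRightDescent w s) :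
    ∃ (k : ℕ) (v : W), (M s t ≠ 0 → k < M s t) ∧
      w = v * cs.wordProd (alternatingWord s t k) ∧ cs.length v < cs.length w ∧
      ¬ cs.IsRightDescent v s ∧ ¬ cs.IsRightDescent v t := by
  classical
  let q (k : ℕ) : W := w * (cs.wordProd (alternatingWord s t k))⁻¹
  have q_succ (k : ℕ) : q (k + 1) = q k * cs.simple (if Even k then t else s) := by
    simp [q, alternatingWord_succ', cs.wordProd_cons, mul_assoc]
  have q_ge (k : ℕ) : cs.length w ≤ cs.length (q k) + k := by
    have h₁ := cs.length_mul_le (q k) (cs.wordProd (alternatingWord s t k))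
    have h₂ := cs.length_wordProd_le (alternatingWord s t k)
    simp only [length_alternatingWord] at h₂
    simp only [q, inv_mul_cancel_right] at h₁ ⊢
    lia
  let P (k : ℕ) : Prop := cs.length (q k) + k = cs.length w
  have hP1 : P 1 := by
    have := cs.isRightDescent_iff.1 ht
    simpa [P, q, alternatingWord] using this
  have hb : 1 ≤ cs.length w := by have : _ + 1 = _ := hP1; lia
  let k := Nat.findGreatest P (cs.length w)
  have hPk : P k := Nat.findGreatest_spec hb hP1
  have hk1 : 1 ≤ k := Nat.le_findGreatest hb hP1
  have hnP : ¬ P (k + 1) := by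
    intro h
    have : k + 1 ≤ k := Nat.le_findGreatest (by have : _ + (k + 1) = _ := h; lia) h
    lia
  have hPk' : cs.length (q k) + k = cs.length w := hPk
  have hnext : ¬ cs.IsRightDescent (q k) (if Even k then t else s) := by
    intro h
    have h' := cs.isRightDescent_iff.1 h
    rw [← q_succ] at h'
    apply hnP
    change _ + _ = _
    lia
  have hprev : ¬ cs.IsRightDescent (q k) (if Even (k - 1) then t else s) := by
    intro h
    have h' := cs.isRightDescent_iff.1 h
    have hq := q_succ (k - 1)
    rw [Nat.sub_add_cancel hk1] at hq
    rw [hq, cs.simple_mul_simple_cancel_right, ← hq] at h'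
    have := q_ge (k - 1)
    lia
  have hw : w = q k * cs.wordProd (alternatingWord s t k) := by simp [q]
  have hparity : Even (k - 1) ↔ ¬ Even k := by
    obtain ⟨j, hj⟩ : ∃ j, k = j + 1 := ⟨k - 1, by lia⟩
    rw [hj]
    simp [Nat.even_add_one]
  refine ⟨k, q k, fun hM ↦ ?_, hw, by lia, ?_, ?_⟩
  · by_contra! hle
    have hnr := cs.not_isReduced_alternatingWord t s (m := k + 1) (by rwa [M.symmetric])
      (by rw [M.symmetric]; lia)
    have hlt := lt_of_le_of_ne (cs.length_wordProd_le (alternatingWord t s (k + 1))) hnr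
    rw [length_alternatingWord] at hlt
    have hws : w * cs.simple s = q k * cs.wordProd (alternatingWord t s (k + 1)) := by
      rw [alternatingWord_succ, cs.wordProd_concat, ← mul_assoc, ← hw]
    have h₁ := cs.not_isRightDescent_iff.1 hs
    have h₂ := cs.length_mul_le (q k) (cs.wordProd (alternatingWord t s (k + 1)))
    rw [← hws] at h₂
    lia
  · by_cases hk : Even k
    · simpa [hparity, hk] using hprev
    · simpa [hk] using hnext
  · by_cases hk : Even k
    · simpa [hk] using hnext
    · simpa [hparity, hk] using hprev

lemma geometricRep_simpleRoot_nonneg {w : W} {s : B} (hs : ¬ cs.IsRightDescent w s) :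
    0 ≤ geometricRep cs w (simpleRoot s) := by
  induction hn : cs.length w using Nat.strong_induction_on generalizing w s with
  | h n ih =>
    obtain rfl | hw := eq_or_ne w 1
    · simpa using simpleRoot_nonneg s
    obtain ⟨t, ht⟩ := cs.exists_rightDescent_of_ne_one hw
    have hst : M s t ≠ 1 := by
      intro h
      obtain rfl := eq_of_coxeterMatrix_eq_one h
      exact hs ht
    obtain ⟨k, v, hkM, rfl, hlt, hvs, hvt⟩ := exists_alternatingWord_factor cs ht hs
    obtain ⟨u, h0, h1, hu, hpos⟩ := exists_nonneg_recurrence hst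
    have hk : 0 ≤ u k := hpos _ fun h ↦ (hkM h).le
    have hk' : 0 ≤ u (k + 1) := hpos _ hkM
    have ihs := ih _ (hn ▸ hlt) hvs rfl
    have iht := ih _ (hn ▸ hlt) hvt rfl
    rw [map_mul, LinearEquiv.mul_apply, geometricRep_alternatingWord cs s t h0 h1 hu]
    split_ifs <;> rw [map_add, map_smul, map_smul] <;>
      exact add_nonneg (smul_nonneg ‹_› ihs) (smul_nonneg ‹_› iht)

lemma geometricRep_simpleRoot_nonpos {w : W} {s : B} (hs : cs.IsRightDescent w s) :
    geometricRep cs w (simpleRoot s) ≤ 0 := by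
  have h := geometricRep_simpleRoot_nonneg cs
    (cs.isRightDescent_iff_not_isRightDescent_mul.1 hs)
  rwa [map_mul, LinearEquiv.mul_apply, geometricRep_simple_simpleRoot, map_neg,
    Left.nonneg_neg_iff] at h

/-- Faithfulness of the geometric representation. -/
lemma eq_one_of_geometricRep_simpleRoot {w : W}
    (h : ∀ s, geometricRep cs w (simpleRoot s) = simpleRoot s) : w = 1 := by
  by_contra hw
  obtain ⟨s, hs⟩ := cs.exists_rightDescent_of_ne_one hw
  have h' := geometricRep_simpleRoot_nonpos cs hs
  rw [h] at h'
  have := h' s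
  simp [simpleRoot] at this
  linarith

/-- The set of roots. -/
def roots : Set (B →₀ ℝ) := {v | ∃ w s, v = geometricRep cs w (simpleRoot s)}

lemma simpleRoot_mem_roots (s : B) : simpleRoot s ∈ roots cs := ⟨1, s, by simp⟩

lemma geometricRep_mem_roots (w : W) {v : B →₀ ℝ} (hv : v ∈ roots cs) :
    geometricRep cs w v ∈ roots cs := by
  obtain ⟨w', s, rfl⟩ := hv
  exact ⟨w * w', s, by simp⟩

lemma neg_mem_roots {v : B →₀ ℝ} (hv : v ∈ roots cs) : -v ∈ roots cs := by
  obtain ⟨w, s, rfl⟩ := hv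
  exact ⟨w * cs.simple s, s, by simp [geometricRep_simple_simpleRoot]⟩

lemma ne_zero_of_mem_roots {v : B →₀ ℝ} (hv : v ∈ roots cs) : v ≠ 0 := by
  obtain ⟨w, s, rfl⟩ := hv
  simp [simpleRoot]

lemma nonneg_or_nonpos_of_mem_roots {v : B →₀ ℝ} (hv : v ∈ roots cs) : 0 ≤ v ∨ v ≤ 0 := by
  obtain ⟨w, s, rfl⟩ := hv
  by_cases hs : cs.IsRightDescent w s
  · exact .inr (geometricRep_simpleRoot_nonpos cs hs)
  · exact .inl (geometricRep_simpleRoot_nonneg cs hs)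

lemma infinite_roots [Infinite W] : (roots cs).Infinite := by
  intro hfin
  have : Finite (roots cs) := hfin
  let f (w : W) : roots cs → roots cs :=
    fun v ↦ ⟨geometricRep cs w v, geometricRep_mem_roots cs w v.2⟩
  refine not_injective_infinite_finite f fun w w' hww ↦ ?_
  rw [← inv_mul_eq_one]
  refine eq_one_of_geometricRep_simpleRoot cs fun s ↦ ?_
  have := congrArg Subtype.val (congrFun hww ⟨_, simpleRoot_mem_roots cs s⟩)
  simp only [f] at this
  rw [map_mul, LinearEquiv.mul_apply, ← this, ← LinearEquiv.mul_apply, ← map_mul]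
  simp

/-- The (doubled) canonical bilinear form on the geometric representation. -/
def canonicalForm (M : CoxeterMatrix B) : (B →₀ ℝ) →ₗ[ℝ] (B →₀ ℝ) →ₗ[ℝ] ℝ :=
  Finsupp.linearCombination ℝ (simpleCoroot M)

lemma canonicalForm_simpleRoot_left (s : B) :
    canonicalForm M (simpleRoot s) = simpleCoroot M s := by
  simp [canonicalForm, simpleRoot]

lemma canonicalForm_simpleRoot_right (s : B) (v : B →₀ ℝ) :
    canonicalForm M v (simpleRoot s) = simpleCoroot M s v := by
  induction v using Finsupp.induction_linear with
  | zero => simp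
  | add f g hf hg => rw [map_add, LinearMap.add_apply, hf, hg, map_add]
  | single t c =>
    have : Finsupp.single t c = c • simpleRoot t := by simp [simpleRoot]
    rw [this, map_smul, LinearMap.smul_apply, canonicalForm_simpleRoot_left, map_smul,
      simpleCoroot_simpleRoot, simpleCoroot_simpleRoot, cartanEntry_comm]

lemma canonicalForm_geometricRep (w : W) (v : B →₀ ℝ) :
    canonicalForm M (geometricRep cs w v) (geometricRep cs w v) = canonicalForm M v v := by
  induction w using cs.simple_induction_left with
  | one => simp
  | mul_simple_left w s ih =>
    rw [← ih, map_mul, LinearEquiv.mul_apply, geometricRep_simple]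
    simp only [map_sub, map_smul, LinearMap.sub_apply, LinearMap.smul_apply, smul_eq_mul,
      canonicalForm_simpleRoot_left, canonicalForm_simpleRoot_right, simpleCoroot_simpleRoot_self]
    ring

/-- A root that is a nonnegative multiple of a simple root equals it. -/
lemma eq_simpleRoot_of_mem_roots {c : ℝ} {s : B} (hc : 0 ≤ c)
    (h : c • simpleRoot s ∈ roots cs) : c • simpleRoot s = simpleRoot s := by
  obtain ⟨w, t, ht⟩ := h
  have hform := canonicalForm_geometricRep cs w (simpleRoot t)
  simp only [← ht, map_smul, LinearMap.smul_apply, canonicalForm_simpleRoot_left,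
    simpleCoroot_simpleRoot_self, smul_eq_mul] at hform
  obtain rfl : c = 1 := by nlinarith
  exact one_smul _ _

lemma nonneg_geometricRep_simple {s : B} {v : B →₀ ℝ} (hv : v ∈ roots cs) (h0 : 0 ≤ v)
    (hne : v ≠ simpleRoot s) : 0 ≤ geometricRep cs (cs.simple s) v := by
  refine (nonneg_or_nonpos_of_mem_roots cs (geometricRep_mem_roots cs _ hv)).resolve_right
    fun hle ↦ hne ?_
  have hvs : v = v s • simpleRoot s := by
    ext t
    obtain rfl | hst := eq_or_ne s t
    · simp [simpleRoot]
    · have := hle t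
      rw [geometricRep_simple] at this
      simp [simpleRoot, Finsupp.single_eq_of_ne hst.symm] at this ⊢
      exact le_antisymm this (h0 t)
  rw [hvs] at hv ⊢
  exact eq_simpleRoot_of_mem_roots cs (h0 s) hv

/-- Every element of `W` makes only finitely many positive roots negative. -/
lemma finite_inversions (w : W) :
    {v | v ∈ roots cs ∧ 0 ≤ v ∧ ¬ 0 ≤ geometricRep cs w v}.Finite := by
  induction w using cs.simple_induction_left with
  | one => simp
  | mul_simple_left w s ih =>
    refine (ih.union (Set.finite_singleton (geometricRep cs w⁻¹ (simpleRoot s)))).subset ?_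
    rintro v ⟨hv, h0, hneg⟩
    by_contra hcon
    simp only [Set.mem_union, Set.mem_ofPred_eq, Set.mem_singleton_iff, not_or, not_and,
      not_not] at hcon
    apply hneg
    rw [map_mul, LinearEquiv.mul_apply]
    refine nonneg_geometricRep_simple cs (geometricRep_mem_roots cs w hv) (hcon.1 hv h0) ?_
    intro h
    apply hcon.2
    rw [← h, ← LinearEquiv.mul_apply, ← map_mul]
    simp

lemma exists_root_orbit_nonneg [Infinite W] (H : Subgroup W) [Finite H] :
    ∃ v ∈ roots cs, ∀ h ∈ H, 0 ≤ geometricRep cs h v := by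
  by_contra! hcon
  have hfin : (⋃ h : H, {v | v ∈ roots cs ∧ 0 ≤ v ∧ ¬ 0 ≤ geometricRep cs (h : W) v}).Finite :=
    Set.finite_iUnion fun h ↦ finite_inversions cs h
  have hpos : {v | v ∈ roots cs ∧ 0 ≤ v}.Finite := hfin.subset fun v ⟨hv, h0⟩ ↦ by
    obtain ⟨h, hh, hneg⟩ := hcon v hv
    exact Set.mem_iUnion.2 ⟨⟨h, hh⟩, hv, h0, hneg⟩
  refine infinite_roots cs ((hpos.union hpos.neg).subset fun v hv ↦ ?_)
  obtain h | h := nonneg_or_nonpos_of_mem_roots cs hv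
  · exact .inl ⟨hv, h⟩
  · exact .inr ⟨neg_mem_roots cs hv, by simpa using h⟩

/-- The sum of the coordinates in the basis of simple roots. -/
def height : (B →₀ ℝ) →ₗ[ℝ] ℝ := Finsupp.linearCombination ℝ fun _ ↦ 1

lemma height_nonneg {v : B →₀ ℝ} (h : 0 ≤ v) : 0 ≤ height v := by
  simpa [height, Finsupp.linearCombination_apply] using
    Finsupp.sum_nonneg fun i _ ↦ h i

lemma height_pos {v : B →₀ ℝ} (h : 0 ≤ v) (hne : v ≠ 0) : 0 < height v := by
  refine (height_nonneg h).lt_of_ne' fun h0 ↦ hne ?_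
  rw [height, Finsupp.linearCombination_apply, Finsupp.sum,
    Finset.sum_eq_zero_iff_of_nonneg fun i _ ↦ by simpa using h i] at h0
  ext i
  by_contra hi
  exact hi (by simpa using h0 i (Finsupp.mem_support_iff.2 hi))

lemma ext_simpleRoot {f g : (B →₀ ℝ) →ₗ[ℝ] ℝ} (h : ∀ s, f (simpleRoot s) = g (simpleRoot s)) :
    f = g :=
  Finsupp.lhom_ext' fun s ↦ LinearMap.ext_ring (h s)

lemma exists_invariant_form [Infinite W] (H : Subgroup W) [Finite H] :
    ∃ F : (B →₀ ℝ) →ₗ[ℝ] ℝ, F ≠ 0 ∧ ∀ h ∈ H, ∀ v, F (geometricRep cs h v) = F v := by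
  have := Fintype.ofFinite H
  let F : (B →₀ ℝ) →ₗ[ℝ] ℝ := ∑ h : H, height ∘ₗ (geometricRep cs (h : W)).toLinearMap
  have hF (v : B →₀ ℝ) : F v = ∑ h : H, height (geometricRep cs (h : W) v) := by
    simp [F]
  refine ⟨F, ?_, fun h hh v ↦ ?_⟩
  · obtain ⟨v, hv, hpos⟩ := exists_root_orbit_nonneg cs H
    intro h0
    have : 0 < F v := by
      rw [hF]
      exact Finset.sum_pos (fun h _ ↦ height_pos (hpos h h.2)
        (ne_zero_of_mem_roots cs (geometricRep_mem_roots cs _ hv))) ⟨1, Finset.mem_univ _⟩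
    simp [h0] at this
  · rw [hF, hF, ← Equiv.sum_comp (Equiv.mulRight (⟨h, hh⟩ : H))
      fun x : H ↦ height (geometricRep cs (x : W) v)]
    simp

lemma cartanEntry_ne_zero_of_adj {s t : B} (h : (coxeterGraph M).Adj s t) :
    cartanEntry M s t ≠ 0 := by
  have hm : M s t = 0 ∨ 3 ≤ M s t := by
    simpa [coxeterGraph, M.symmetric t s] using h.2
  have hcos : 0 < Real.cos (Real.pi / M s t) := by
    obtain hm | hm := hm
    · simp [hm]
    · have h3 : (3 : ℝ) ≤ M s t := by exact_mod_cast hm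
      have h0 : (0 : ℝ) < M s t := by linarith
      refine Real.cos_pos_of_mem_Ioo ⟨?_, ?_⟩
      · have : 0 < Real.pi / M s t := by positivity
        linarith [Real.pi_pos]
      · rw [div_lt_iff₀ h0]
        nlinarith [Real.pi_pos]
  rw [cartanEntry]
  exact (by linarith : -2 * Real.cos (Real.pi / M s t) < 0).ne

/-- The forms invariant under a normal subgroup are stable under `W`. -/
lemma invariant_comp_simple {H : Subgroup W} (hH : H.Normal) {F : (B →₀ ℝ) →ₗ[ℝ] ℝ}
    (hF : ∀ h ∈ H, ∀ v, F (geometricRep cs h v) = F v) (s : B) {h : W} (hh : h ∈ H)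
    (v : B →₀ ℝ) :
    F (simpleRoot s) * simpleCoroot M s (geometricRep cs h v) =
      F (simpleRoot s) * simpleCoroot M s v := by
  have h₁ := hF _ (hH.conj_mem h hh (cs.simple s)) (geometricRep cs (cs.simple s) v)
  rw [← LinearEquiv.mul_apply, ← map_mul, inv_mul_cancel_right, map_mul, LinearEquiv.mul_apply,
    geometricRep_simple, geometricRep_simple, map_sub, map_sub, map_smul, map_smul, hF h hh,
    smul_eq_mul, smul_eq_mul] at h₁
  linarith

lemma simpleCoroot_invariant [Infinite W] (hirr : (coxeterGraph M).Connected) {H : Subgroup W}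
    [Finite H] (hH : H.Normal) (s : B) :
    ∀ h ∈ H, ∀ v, simpleCoroot M s (geometricRep cs h v) = simpleCoroot M s v := by
  obtain ⟨F, hF0, hF⟩ := exists_invariant_form cs H
  obtain ⟨r, hr⟩ : ∃ r, F (simpleRoot r) ≠ 0 := by
    by_contra! h
    exact hF0 (ext_simpleRoot (by simpa using h))
  obtain ⟨p⟩ := hirr.preconnected s r
  induction p with
  | nil => exact fun h hh v ↦ mul_left_cancel₀ hr (invariant_comp_simple cs hH hF _ hh v)
  | cons hadj p ih =>
    refine fun h hh v ↦ mul_left_cancel₀ ?_ (invariant_comp_simple cs hH (ih hr) _ hh v)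
    rw [simpleCoroot_simpleRoot]
    exact cartanEntry_ne_zero_of_adj hadj.symm

lemma geometricRep_eq_self_of_simpleCoroot_eq_zero {r : B →₀ ℝ}
    (hr : ∀ s, simpleCoroot M s r = 0) (w : W) : geometricRep cs w r = r := by
  induction w using cs.simple_induction_left with
  | one => simp
  | mul_simple_left w s ih =>
    rw [map_mul, LinearEquiv.mul_apply, ih, geometricRep_simple, hr, zero_smul, sub_zero]

end GeometricRep

/-- In an irreducible Coxeter system with `W` infinite, a non-trivial finite
subgroup of `W` is never normal. -/
theorem finite_subgroup_not_normal [Fintype B] {M : CoxeterMatrix B} (cs : CoxeterSystem M W)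
    (hirr : (coxeterGraph M).Connected) (hinf : Infinite W)
    (H : Subgroup W) (hHne : H ≠ ⊥) (hHfin : Finite H) :
    ¬ H.Normal := by
  intro hH
  refine hHne ((Subgroup.eq_bot_iff_forall H).2 fun h hh ↦ ?_)
  refine eq_one_of_geometricRep_simpleRoot cs fun s ↦ ?_
  set r := geometricRep cs h (simpleRoot s) - simpleRoot s with hr
  have hr0 (t : B) : simpleCoroot M t r = 0 := by
    rw [hr, map_sub, simpleCoroot_invariant cs hirr hH t h hh, sub_self]
  have hpow (n : ℕ) : geometricRep cs (h ^ n) (simpleRoot s) = simpleRoot s + (n : ℝ) • r := by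
    induction n with
    | zero => simp
    | succ n ih =>
      rw [pow_succ', map_mul, LinearEquiv.mul_apply, ih, map_add, map_smul,
        geometricRep_eq_self_of_simpleCoroot_eq_zero cs hr0, hr]
      push_cast
      module
  have hord : 0 < orderOf (⟨h, hh⟩ : H) := orderOf_pos _
  have hone : h ^ orderOf (⟨h, hh⟩ : H) = 1 :=
    congrArg Subtype.val (pow_orderOf_eq_one (⟨h, hh⟩ : H))
  have h0 := hpow (orderOf (⟨h, hh⟩ : H))
  rw [hone, map_one, LinearEquiv.coe_one, id, left_eq_add, smul_eq_zero] at h0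
  exact sub_eq_zero.1 (h0.resolve_left (by exact_mod_cast hord.ne'))

end CoxeterPaper
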